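/- arXiv:1206.5889 — 2 statements merged into one kernel-verified Lean document; each statement's English description precedes it below -/
import Mathlib

section
/- For every p ≥ 1, the space 𝕃^p(Ω) is a Banach space under the norm X ↦ (Ê[|X|^p])^{1/p}: this functional satisfies the triangle inequality on 𝕃^p(Ω), and for every sequence (X_n) in 𝕃^p(Ω) that is Cauchy in the sense that Ê[|X_n − X_m|^p] → 0 as n, m → ∞, there exists a measurable X ∈ 𝕃^p(Ω) with Ê[|X_n − X|^p] → 0. -/
open MeasureTheory Filter Topology

noncomputable section

/-- The upper expectation of `|X|^p`: `Ê[|X|^p] = sup_{P ∈ 𝒫} E_P[|X|^p]`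
(valued in `ℝ≥0∞`). -/
def upperLp {Ω : Type*} [MeasurableSpace Ω]
    (Ps : Set (Measure Ω)) (p : ℝ) (X : Ω → ℝ) : ENNReal :=
  ⨆ P : Ps, ∫⁻ ω, ENNReal.ofReal |X ω| ^ p ∂P.1

section

variable {Ω : Type*} [MeasurableSpace Ω] {Ps : Set (Measure Ω)} {p : ℝ}

theorem upperLp_rpow_eq_iSup_eLpNorm (hp : 0 < p) (X : Ω → ℝ) :
    upperLp Ps p X ^ (1 / p) = ⨆ P : Ps, eLpNorm X (ENNReal.ofReal p) P.1 := by
  have hp' : 0 < 1 / p := by positivity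
  rw [upperLp, ← ENNReal.orderIsoRpow_apply (1 / p) hp', OrderIso.map_iSup]
  congr 1 with P
  rw [ENNReal.orderIsoRpow_apply, eLpNorm_eq_lintegral_rpow_enorm_toReal (by simpa using hp)
    ENNReal.ofReal_ne_top, ENNReal.toReal_ofReal hp.le]
  simp only [Real.enorm_eq_ofReal_abs]

theorem eLpNorm_le_upperLp_rpow (hp : 0 < p) {P : Measure Ω} (hP : P ∈ Ps) (X : Ω → ℝ) :
    eLpNorm X (ENNReal.ofReal p) P ≤ upperLp Ps p X ^ (1 / p) := by
  rw [upperLp_rpow_eq_iSup_eLpNorm hp]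
  exact le_iSup (fun P : Ps => eLpNorm X (ENNReal.ofReal p) P.1) ⟨P, hP⟩

theorem upperLp_rpow_le (hp : 0 < p) {X : Ω → ℝ} {c : ENNReal}
    (h : ∀ P ∈ Ps, eLpNorm X (ENNReal.ofReal p) P ≤ c) : upperLp Ps p X ^ (1 / p) ≤ c := by
  rw [upperLp_rpow_eq_iSup_eLpNorm hp]
  exact iSup_le fun P => h P.1 P.2

theorem upperLp_rpow_add_le (hp : 1 ≤ p) {X Y : Ω → ℝ} (hX : Measurable X) (hY : Measurable Y) :
    upperLp Ps p (X + Y) ^ (1 / p) ≤ upperLp Ps p X ^ (1 / p) + upperLp Ps p Y ^ (1 / p) := by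
  have hp0 : 0 < p := by linarith
  refine upperLp_rpow_le hp0 fun P hP => ?_
  refine (eLpNorm_add_le hX.aestronglyMeasurable hY.aestronglyMeasurable
    (by simpa using hp)).trans ?_
  gcongr <;> exact eLpNorm_le_upperLp_rpow hp0 hP _

theorem upperLp_neg (X : Ω → ℝ) : upperLp Ps p (-X) = upperLp Ps p X := by
  simp [upperLp]

theorem tendsto_upperLp_rpow_zero_iff (hp : 0 < p) {ι : Type*} {l : Filter ι}
    {X : ι → Ω → ℝ} :
    Tendsto (fun i => upperLp Ps p (X i) ^ (1 / p)) l (𝓝 0) ↔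
      Tendsto (fun i => upperLp Ps p (X i)) l (𝓝 0) := by
  constructor <;> intro h
  · have := (ENNReal.continuous_rpow_const (y := p)).tendsto 0 |>.comp h
    simpa [Function.comp_def, ← ENNReal.rpow_mul, hp, hp.ne'] using this
  · have := (ENNReal.continuous_rpow_const (y := 1 / p)).tendsto 0 |>.comp h
    simpa [Function.comp_def, hp] using this

/-- Fast Cauchy sequences have a common limit, with an error bound uniform over `Ps`. -/
theorem exists_measurable_forall_eLpNorm_sub_le (hp : 1 ≤ p) {X : ℕ → Ω → ℝ}
    (hX : ∀ n, Measurable (X n)) {φ : ℕ → ℕ} (hφ : StrictMono φ) {B : ℕ → ENNReal}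
    (hB : ∑' k, B k ≠ ⊤)
    (hXB : ∀ P ∈ Ps, ∀ k n m, φ k ≤ n → φ k ≤ m →
      eLpNorm (X n - X m) (ENNReal.ofReal p) P < B k) :
    ∃ Y : Ω → ℝ, Measurable Y ∧ ∀ P ∈ Ps, ∀ k n, φ k ≤ n →
      eLpNorm (X n - Y) (ENNReal.ofReal p) P ≤ B k := by
  refine ⟨fun ω => limsup (fun k => X (φ k) ω) atTop, Measurable.limsup fun k => hX (φ k),
    fun P hP k n hn => ?_⟩
  have hlim : ∀ᵐ ω ∂P, Tendsto (fun j => (X n - X (φ j)) ω) atTop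
      (𝓝 ((X n - fun ω => limsup (fun k => X (φ k) ω) atTop) ω)) := by
    filter_upwards [Lp.ae_tendsto_of_cauchy_eLpNorm (f := fun k => X (φ k))
      (fun k => (hX (φ k)).aestronglyMeasurable) (by simpa using hp) hB
      (fun N i j hi hj => hXB P hP N _ _ (hφ.monotone hi) (hφ.monotone hj))] with ω ⟨l, hl⟩
    simp only [Pi.sub_apply, hl.limsup_eq]
    exact hl.const_sub _
  refine (Lp.eLpNorm_lim_le_liminf_eLpNorm
    (fun j => ((hX n).sub (hX (φ j))).aestronglyMeasurable) _ hlim).trans ?_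
  refine liminf_le_of_frequently_le' (Eventually.frequently ?_)
  filter_upwards [eventually_ge_atTop k] with j hj
  exact (hXB P hP k _ _ hn (hφ.monotone hj)).le

end

/-- for `p ≥ 1` the space `𝕃^p(Ω) = {X measurable : Ê[|X|^p] < ∞}` is a
Banach space under `X ↦ (Ê[|X|^p])^{1/p}`: the triangle inequality holds, and every sequence
which is Cauchy in the sense that `Ê[|X_n − X_m|^p] → 0` converges to some measurable
`X ∈ 𝕃^p(Ω)` with `Ê[|X_n − X|^p] → 0`. -/
theorem upperLp_banach {Ω : Type*} [MeasurableSpace Ω]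
    (Ps : Set (Measure Ω)) (hPsne : Ps.Nonempty)
    (hPsprob : ∀ P ∈ Ps, IsProbabilityMeasure P)
    (p : ℝ) (hp : 1 ≤ p) :
    (∀ X Y : Ω → ℝ, Measurable X → Measurable Y →
        upperLp Ps p X < ⊤ → upperLp Ps p Y < ⊤ →
        upperLp Ps p (X + Y) ^ (1 / p) ≤
          upperLp Ps p X ^ (1 / p) + upperLp Ps p Y ^ (1 / p)) ∧
    (∀ X : ℕ → Ω → ℝ, (∀ n, Measurable (X n)) → (∀ n, upperLp Ps p (X n) < ⊤) →
        Tendsto (fun q : ℕ × ℕ => upperLp Ps p (X q.1 - X q.2)) atTop (nhds 0) →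
        ∃ Y : Ω → ℝ, Measurable Y ∧ upperLp Ps p Y < ⊤ ∧
          Tendsto (fun n => upperLp Ps p (X n - Y)) atTop (nhds 0)) := by
  have hp0 : 0 < p := by linarith
  refine ⟨fun X Y hX hY _ _ => upperLp_rpow_add_le hp hX hY, fun X hX hXfin hcau => ?_⟩
  have hcau' := (tendsto_upperLp_rpow_zero_iff hp0).2 hcau
  have hsmall : ∀ k : ℕ, ∀ᶠ N in atTop, ∀ n m, N ≤ n → N ≤ m →
      upperLp Ps p (X n - X m) ^ (1 / p) < (2⁻¹ : ENNReal) ^ k := by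
    intro k
    have hpos : (0 : ENNReal) < 2⁻¹ ^ k := ENNReal.pow_pos (by simp) k
    obtain ⟨⟨a, b⟩, hab⟩ := eventually_atTop.1 (hcau'.eventually (gt_mem_nhds hpos))
    filter_upwards [eventually_ge_atTop a, eventually_ge_atTop b] with N ha hb n m hn hm
    exact hab (n, m) ⟨ha.trans hn, hb.trans hm⟩
  obtain ⟨φ, hφ, hφX⟩ := extraction_forall_of_eventually hsmall
  obtain ⟨Y, hY, hXY⟩ := exists_measurable_forall_eLpNorm_sub_le (Ps := Ps) hp hX hφ
    (B := fun k => (2⁻¹ : ENNReal) ^ k) (by simp [ENNReal.tsum_geometric])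
    (fun P hP k n m hn hm =>
      (eLpNorm_le_upperLp_rpow hp0 hP _).trans_lt (hφX k n m hn hm))
  have hbound : ∀ k n, φ k ≤ n → upperLp Ps p (X n - Y) ^ (1 / p) ≤ (2⁻¹ : ENNReal) ^ k :=
    fun k n hn => upperLp_rpow_le hp0 fun P hP => hXY P hP k n hn
  refine ⟨Y, hY, ?_, (tendsto_upperLp_rpow_zero_iff hp0).1 ?_⟩
  · have htri := upperLp_rpow_add_le (Ps := Ps) hp (hX (φ 0)) ((hX (φ 0)).sub hY).neg
    rw [upperLp_neg, show X (φ 0) + -(X (φ 0) - Y) = Y by abel] at htri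
    rw [← ENNReal.rpow_lt_top_iff_of_pos (show 0 < 1 / p by positivity)]
    refine htri.trans_lt (ENNReal.add_lt_top.2 ⟨?_, (hbound 0 _ le_rfl).trans_lt (by simp)⟩)
    exact (ENNReal.rpow_lt_top_iff_of_pos (by positivity)).2 (hXfin _)
  · refine ENNReal.tendsto_nhds_zero.2 fun ε hε => ?_
    obtain ⟨k, hk⟩ := ((ENNReal.tendsto_pow_atTop_nhds_zero_of_lt_one
      (r := 2⁻¹) (by simp)).eventually (gt_mem_nhds hε)).exists
    filter_upwards [eventually_ge_atTop (φ k)] with n hn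
    exact (hbound k n hn).trans hk.le

end
end

section
/- If u is a bounded classical solution of the terminal value problem ∂_t u + G(∂²_{xx} u) + h(u, ∂_x u) = 0 on [0,T) × ℝ with u(T, ·) = φ, then |u(t,x) − u(t,y)| ≤ L_φ e^{L_h (T−t)} |x − y| for all t ∈ [0,T] and x, y ∈ ℝ; in particular |∂_x u(t,x)| ≤ L_φ e^{L_h T} for all (t,x) ∈ [0,T) × ℝ. -/
open Set Real

noncomputable section

/-- Second derivative test, necessary condition. -/
theorem IsLocalMax.second_deriv_nonpos {f f' : ℝ → ℝ} {f'' x : ℝ}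
    (hf : ∀ᶠ s in nhds x, HasDerivAt f (f' s) s) (hf' : HasDerivAt f' f'' x)
    (hmax : IsLocalMax f x) : f'' ≤ 0 := by
  by_contra! hpos
  have hd : deriv f =ᶠ[nhds x] f' := hf.mono fun s hs => hs.deriv
  have hdd : deriv (deriv f) x = f'' := by rw [hd.deriv_eq, hf'.deriv]
  have hmin : IsLocalMin f x :=
    isLocalMin_of_deriv_deriv_pos (hdd ▸ hpos) hmax.deriv_eq_zero hf.self_of_nhds.continuousAt
  have hconst : f =ᶠ[nhds x] fun _ => f x := by
    filter_upwards [hmax, hmin] with s h₁ h₂ using le_antisymm h₁ h₂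
  have hd0 : deriv f =ᶠ[nhds x] fun _ => 0 := by simpa using hconst.deriv
  have : deriv (deriv f) x = 0 := by rw [hd0.deriv_eq]; simp
  linarith

/-- A right derivative at a maximum over `[a, b]`, taken at a point of `[a, b)`, is nonpositive. -/
theorem HasDerivWithinAt.nonpos_of_isMaxOn_Icc {f : ℝ → ℝ} {f' a b t : ℝ} (ht : t ∈ Ico a b)
    (hf : HasDerivWithinAt f f' (Ici t) t) (hmax : ∀ s ∈ Icc a b, f s ≤ f t) : f' ≤ 0 := by
  have hf' := hasDerivWithinAt_iff_tendsto_slope' (by simp) |>.1 (hf.mono Ioi_subset_Ici_self)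
  refine le_of_tendsto hf' ?_
  filter_upwards [Ioo_mem_nhdsGT ht.2] with s hs
  rw [slope_def_field]
  exact div_nonpos_of_nonpos_of_nonneg
    (sub_nonpos.2 (hmax s ⟨ht.1.trans hs.1.le, hs.2.le⟩)) (sub_nonneg.2 hs.1.le)

theorem hasDerivAt_log_one_add_sq (x : ℝ) :
    HasDerivAt (fun s : ℝ => log (1 + s ^ 2)) (2 * x / (1 + x ^ 2)) x := by
  have := ((hasDerivAt_pow 2 x).const_add 1).log (by positivity)
  simpa using this

theorem hasDerivAt_two_mul_div_one_add_sq (x : ℝ) :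
    HasDerivAt (fun s : ℝ => 2 * s / (1 + s ^ 2))
      ((2 * (1 + x ^ 2) - 2 * x * (2 * x)) / (1 + x ^ 2) ^ 2) x := by
  have := ((hasDerivAt_id x).const_mul 2).fun_div ((hasDerivAt_pow 2 x).const_add 1)
    (by positivity)
  simpa using this

theorem abs_two_mul_div_one_add_sq_le (x : ℝ) : |2 * x / (1 + x ^ 2)| ≤ 1 := by
  have h : 0 < 1 + x ^ 2 := by positivity
  rw [abs_div, abs_of_pos h, div_le_one h, abs_le]
  constructor <;> nlinarith [sq_nonneg (x - 1), sq_nonneg (x + 1)]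

/-- First and second order conditions at a maximum of `f` penalised by `A |· - y|` and by
`ε log (1 + ·²)`, away from the kink. -/
theorem deriv_conditions_of_isMax_penalised {f f' : ℝ → ℝ} {f'' A ε x y : ℝ} (hε : 0 ≤ ε)
    (hf : ∀ s, HasDerivAt f (f' s) s) (hf' : HasDerivAt f' f'' x) (hxy : x ≠ y)
    (hmax : ∀ s, f s - A * |s - y| - ε * log (1 + s ^ 2)
      ≤ f x - A * |x - y| - ε * log (1 + x ^ 2)) :
    f' x = A * SignType.sign (x - y) + ε * (2 * x / (1 + x ^ 2)) ∧ f'' ≤ 2 * ε := by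
  set c : ℝ := ((SignType.sign (x - y) : SignType) : ℝ) with hc
  set g : ℝ → ℝ := fun s => f s - A * (c * (s - y)) - ε * log (1 + s ^ 2) with hg
  have hgd : ∀ s, HasDerivAt g (f' s - A * c - ε * (2 * s / (1 + s ^ 2))) s := fun s => by
    have h₁ := ((((hasDerivAt_id s).sub_const y).const_mul c).const_mul A)
    have := ((hf s).fun_sub h₁).fun_sub ((hasDerivAt_log_one_add_sq s).const_mul ε)
    simpa using this
  have hgdd : HasDerivAt (fun s => f' s - A * c - ε * (2 * s / (1 + s ^ 2)))
      (f'' - ε * ((2 * (1 + x ^ 2) - 2 * x * (2 * x)) / (1 + x ^ 2) ^ 2)) x :=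
    (hf'.sub_const _).sub ((hasDerivAt_two_mul_div_one_add_sq x).const_mul ε)
  have habs : ∀ᶠ s in nhds x, |s - y| = c * (s - y) := by
    rcases lt_or_gt_of_ne hxy with hlt | hgt
    · filter_upwards [Iio_mem_nhds hlt] with s hs
      have hs : s < y := hs
      rw [hc, sign_neg (sub_neg.2 hlt), abs_of_neg (sub_neg.2 hs)]
      simp
    · filter_upwards [Ioi_mem_nhds hgt] with s hs
      have hs : y < s := hs
      rw [hc, sign_pos (sub_pos.2 hgt), abs_of_pos (sub_pos.2 hs)]
      simp
  have hgmax : IsLocalMax g x := by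
    filter_upwards [habs] with s hs
    have := hmax s
    rw [hs, habs.self_of_nhds] at this
    exact this
  refine ⟨by linarith [hgmax.hasDerivAt_eq_zero (hgd x)], ?_⟩
  have h₁ := hgmax.second_deriv_nonpos (Filter.Eventually.of_forall hgd) hgdd
  have h₂ : (2 * (1 + x ^ 2) - 2 * x * (2 * x)) / (1 + x ^ 2) ^ 2 ≤ 2 := by
    rw [div_le_iff₀ (by positivity)]
    nlinarith [sq_nonneg x, sq_nonneg (x ^ 2)]
  nlinarith [mul_le_mul_of_nonneg_left h₂ hε]

/-- A continuous function on `[0, T] × ℝ²` that is at most `C - ε (log (1 + x²) + log (1 + y²))` and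
positive somewhere attains its maximum. -/
theorem exists_max_of_le_sub_log {T C ε : ℝ} (hε : 0 < ε) {w : ℝ × ℝ × ℝ → ℝ}
    (hw : ContinuousOn w (Icc 0 T ×ˢ univ))
    (hle : ∀ t ∈ Icc 0 T, ∀ x y, w (t, x, y) ≤ C - ε * (log (1 + x ^ 2) + log (1 + y ^ 2)))
    {t₀ x₀ y₀ : ℝ} (ht₀ : t₀ ∈ Icc 0 T) (hpos : 0 < w (t₀, x₀, y₀)) :
    ∃ t ∈ Icc 0 T, ∃ x y, 0 < w (t, x, y) ∧
      ∀ s ∈ Icc 0 T, ∀ a b, w (s, a, b) ≤ w (t, x, y) := by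
  set R := exp (C / ε)
  have hlog : ∀ z : ℝ, 0 ≤ log (1 + z ^ 2) := fun z => log_nonneg (by nlinarith [sq_nonneg z])
  have hbound : ∀ z : ℝ, ε * log (1 + z ^ 2) < C → z ∈ Icc (-R) R := fun z hz => by
    have h₁ : log (1 + z ^ 2) < C / ε := by rw [lt_div_iff₀ hε]; linarith
    have h₂ : 1 + z ^ 2 < R := (log_lt_iff_lt_exp (by positivity)).1 h₁
    constructor <;> nlinarith [sq_nonneg (z - 1), sq_nonneg (z + 1)]
  have hbox : ∀ t ∈ Icc 0 T, ∀ x y, 0 < w (t, x, y) →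
      (t, x, y) ∈ Icc 0 T ×ˢ (Icc (-R) R ×ˢ Icc (-R) R) := fun t ht x y h => by
    have := hle t ht x y
    have h₁ := mul_nonneg hε.le (hlog x)
    have h₂ := mul_nonneg hε.le (hlog y)
    exact ⟨ht, hbound x (by linarith), hbound y (by linarith)⟩
  obtain ⟨⟨t, x, y⟩, ⟨ht, -⟩, hm⟩ :=
    (isCompact_Icc.prod (isCompact_Icc.prod isCompact_Icc)).exists_isMaxOn
      ⟨_, hbox t₀ ht₀ x₀ y₀ hpos⟩ (hw.mono (prod_mono_right (subset_univ _)))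
  have hp : 0 < w (t, x, y) := hpos.trans_le (hm (hbox t₀ ht₀ x₀ y₀ hpos))
  refine ⟨t, ht, x, y, hp, fun s hs a b => ?_⟩
  by_cases h : 0 < w (s, a, b)
  · exact hm (hbox s hs a b h)
  · exact (not_lt.1 h).trans hp.le

/-- a bounded classical solution `u` of the terminal value problem
`∂_t u + G(∂²_{xx} u) + h(u, ∂_x u) = 0` on `[0,T) × ℝ`, `u(T,·) = φ`, where
`G(a) = ½(σ̄² a⁺ − σ_² a⁻)`, `h` is `L_h`-Lipschitz and `φ` is bounded and
`L_φ`-Lipschitz, satisfies `|u(t,x) − u(t,y)| ≤ L_φ e^{L_h (T−t)} |x−y|`; in particular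
`|∂_x u(t,x)| ≤ L_φ e^{L_h T}` on `[0,T) × ℝ`. -/
theorem g_heat_equation_lipschitz_in_space
    (T : ℝ) (hT : 0 < T)
    (σu σl : ℝ) (hσl : 0 < σl) (hσ : σl ≤ σu)
    (Lh Lφ : NNReal)
    (h : ℝ × ℝ → ℝ) (hh : LipschitzWith Lh h)
    (φ : ℝ → ℝ) (hφ : LipschitzWith Lφ φ) (hφbdd : ∃ M : ℝ, ∀ x, |φ x| ≤ M)
    -- `u` is a bounded classical solution, with `∂_t u = ut`, `∂_x u = ux`, `∂²_{xx} u = uxx`: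
    (u ut ux uxx : ℝ → ℝ → ℝ)
    (hubdd : ∃ M : ℝ, ∀ t ∈ Icc 0 T, ∀ x : ℝ, |u t x| ≤ M)
    (hucont : ContinuousOn (fun p : ℝ × ℝ => u p.1 p.2) (Icc 0 T ×ˢ univ))
    (hut : ∀ t ∈ Ico 0 T, ∀ x : ℝ,
      HasDerivWithinAt (fun s => u s x) (ut t x) (Ici t) t)
    (hux : ∀ t ∈ Ico 0 T, ∀ x : ℝ, HasDerivAt (fun y => u t y) (ux t x) x)
    (huxx : ∀ t ∈ Ico 0 T, ∀ x : ℝ, HasDerivAt (fun y => ux t y) (uxx t x) x)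
    (hutcont : ContinuousOn (fun p : ℝ × ℝ => ut p.1 p.2) (Ico 0 T ×ˢ univ))
    (huxcont : ContinuousOn (fun p : ℝ × ℝ => ux p.1 p.2) (Ico 0 T ×ˢ univ))
    (huxxcont : ContinuousOn (fun p : ℝ × ℝ => uxx p.1 p.2) (Ico 0 T ×ˢ univ))
    -- the PDE `∂_t u + G(∂²_{xx} u) + h(u, ∂_x u) = 0` with `G(a) = ½(σ̄² a⁺ − σ_² a⁻)`:
    (hpde : ∀ t ∈ Ico 0 T, ∀ x : ℝ,
      ut t x + 1 / 2 * (σu ^ 2 * max (uxx t x) 0 - σl ^ 2 * max (-uxx t x) 0)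
        + h (u t x, ux t x) = 0)
    -- the terminal condition:
    (hterm : ∀ x : ℝ, u T x = φ x) :
    (∀ t ∈ Icc 0 T, ∀ x y : ℝ,
        |u t x - u t y| ≤ (Lφ : ℝ) * Real.exp ((Lh : ℝ) * (T - t)) * |x - y|) ∧
    (∀ t ∈ Ico 0 T, ∀ x : ℝ, |ux t x| ≤ (Lφ : ℝ) * Real.exp ((Lh : ℝ) * T)) := by
  have key : ∀ ε > 0, ∀ t ∈ Icc 0 T, ∀ x y : ℝ,
      exp (-(Lh * (T - t))) * (u t x - u t y) - Lφ * |x - y|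
        - ε * (log (1 + x ^ 2) + log (1 + y ^ 2))
        - (2 * σu ^ 2 + 2 * Lh + 1) * ε * (T - t) ≤ 0 := by
    intro ε hε t₀ ht₀ x₀ y₀
    by_contra! hpos
    obtain ⟨M, hM⟩ := hubdd
    have hlog : ∀ z : ℝ, 0 ≤ log (1 + z ^ 2) := fun z => log_nonneg (by nlinarith [sq_nonneg z])
    have hσu : 0 ≤ σu ^ 2 := sq_nonneg σu
    have hLh : (0 : ℝ) ≤ Lh := Lh.coe_nonneg
    have hLφ : (0 : ℝ) ≤ Lφ := Lφ.coe_nonneg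
    set δ := (2 * σu ^ 2 + 2 * Lh + 1) * ε with hδ
    have hδ0 : 0 < δ := by positivity
    obtain ⟨t, ht, x, y, hp, hmax⟩ := exists_max_of_le_sub_log (T := T) (C := 2 * M) hε
      (w := fun p => exp (-(Lh * (T - p.1))) * (u p.1 p.2.1 - u p.1 p.2.2) - Lφ * |p.2.1 - p.2.2|
        - ε * (log (1 + p.2.1 ^ 2) + log (1 + p.2.2 ^ 2)) - δ * (T - p.1))
      (by
        have h₁ : ContinuousOn (fun p : ℝ × ℝ × ℝ => u p.1 p.2.1) (Icc 0 T ×ˢ univ) :=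
          hucont.comp (f := fun p : ℝ × ℝ × ℝ => (p.1, p.2.1)) (by fun_prop)
            fun p hp => ⟨hp.1, mem_univ _⟩
        have h₂ : ContinuousOn (fun p : ℝ × ℝ × ℝ => u p.1 p.2.2) (Icc 0 T ×ˢ univ) :=
          hucont.comp (f := fun p : ℝ × ℝ × ℝ => (p.1, p.2.2)) (by fun_prop)
            fun p hp => ⟨hp.1, mem_univ _⟩
        have h₃ : Continuous fun z : ℝ => log (1 + z ^ 2) :=
          (by fun_prop : Continuous fun z : ℝ => 1 + z ^ 2).log fun z => by positivity
        have h₄ : Continuous fun p : ℝ × ℝ × ℝ => log (1 + p.2.1 ^ 2) := h₃.comp (by fun_prop)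
        have h₅ : Continuous fun p : ℝ × ℝ × ℝ => log (1 + p.2.2 ^ 2) := h₃.comp (by fun_prop)
        have h₆ : Continuous fun p : ℝ × ℝ × ℝ => exp (-(Lh * (T - p.1))) := by fun_prop
        exact (((h₆.continuousOn.mul (h₁.sub h₂)).sub (by fun_prop)).sub
          (continuous_const.mul (h₄.add h₅)).continuousOn).sub (by fun_prop))
      (fun t ht x y => by
        have h₁ := abs_le.1 (hM t ht x)
        have h₂ := abs_le.1 (hM t ht y)
        have h₃ : exp (-(Lh * (T - t))) ≤ 1 :=
          exp_le_one_iff.2 (neg_nonpos.2 (mul_nonneg hLh (sub_nonneg.2 ht.2)))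
        have h₄ : exp (-(Lh * (T - t))) * (u t x - u t y) ≤ 2 * M := by
          have h₅ := mul_le_mul_of_nonneg_left (show u t x - u t y ≤ 2 * M by linarith)
            (exp_pos (-(Lh * (T - t)))).le
          nlinarith
        have h₅ : 0 ≤ Lφ * |x - y| := by positivity
        have h₆ : 0 ≤ δ * (T - t) := mul_nonneg hδ0.le (sub_nonneg.2 ht.2)
        dsimp only
        linarith)
      ht₀ hpos
    dsimp only at hp hmax
    have hxy : x ≠ y := by
      rintro rfl
      have h₁ : 0 ≤ δ * (T - t) := mul_nonneg hδ0.le (sub_nonneg.2 ht.2)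
      have h₂ := mul_nonneg hε.le (add_nonneg (hlog x) (hlog x))
      simp only [sub_self, abs_zero, mul_zero] at hp
      linarith
    have htT : t < T := by
      refine lt_of_le_of_ne ht.2 ?_
      rintro rfl
      have h₁ := mul_nonneg hε.le (add_nonneg (hlog x) (hlog y))
      have h₂ := hφ.dist_le_mul x y
      rw [Real.dist_eq, Real.dist_eq] at h₂
      simp only [sub_self, mul_zero, neg_zero, exp_zero, hterm] at hp
      linarith [le_abs_self (φ x - φ y)]
    have ht' : t ∈ Ico 0 T := ⟨ht.1, htT⟩
    set E := exp (-(Lh * (T - t))) with hE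
    have hE0 : 0 < E := exp_pos _
    obtain ⟨hx₁, hx₂⟩ := deriv_conditions_of_isMax_penalised (f := fun s => E * u t s)
      (A := Lφ) hε.le (fun s => (hux t ht' s).const_mul E) ((huxx t ht' x).const_mul E) hxy
      (fun s => by linarith [hmax t ht s y])
    obtain ⟨hy₁, hy₂⟩ := deriv_conditions_of_isMax_penalised (f := fun s => -E * u t s)
      (A := Lφ) hε.le (fun s => (hux t ht' s).const_mul (-E)) ((huxx t ht' y).const_mul (-E))
      hxy.symm (fun s => by
        have := hmax t ht x s
        rw [abs_sub_comm x s, abs_sub_comm x y] at this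
        linarith)
    have htime : HasDerivWithinAt (fun s => exp (-(Lh * (T - s))) * (u s x - u s y) - Lφ * |x - y|
        - ε * (log (1 + x ^ 2) + log (1 + y ^ 2)) - δ * (T - s))
        (E * Lh * (u t x - u t y) + E * (ut t x - ut t y) + δ) (Ici t) t := by
      have h₁ : HasDerivAt (fun s => T - s) (-1) t := by
        simpa using (hasDerivAt_id t).const_sub T
      have h₂ : HasDerivAt (fun s => exp (-(Lh * (T - s)))) (E * Lh) t := by
        simpa using ((h₁.const_mul (Lh : ℝ)).fun_neg).exp
      have h₃ := (((h₂.hasDerivWithinAt.fun_mul ((hut t ht' x).fun_sub (hut t ht' y))).sub_const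
        (Lφ * |x - y|)).sub_const (ε * (log (1 + x ^ 2) + log (1 + y ^ 2)))).fun_sub
        (h₁.const_mul δ).hasDerivWithinAt
      exact h₃.congr_deriv (by ring)
    have hneg := htime.nonpos_of_isMaxOn_Icc ht' fun s hs => hmax s hs x y
    have hD : 0 ≤ u t x - u t y := by
      have h₁ : 0 ≤ δ * (T - t) := mul_nonneg hδ0.le (sub_nonneg.2 ht.2)
      have h₂ := mul_nonneg hε.le (add_nonneg (hlog x) (hlog y))
      have h₃ : 0 ≤ Lφ * |x - y| := by positivity
      exact nonneg_of_mul_nonneg_right (by linarith) hE0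
    have hgrad : E * |ux t x - ux t y| ≤ 2 * ε := by
      have hs : ((SignType.sign (y - x) : SignType) : ℝ) = -(SignType.sign (x - y) : SignType) := by
        rw [← neg_sub x y, Left.sign_neg, SignType.coe_neg]
      rw [hs] at hy₁
      have h₁ : E * (ux t x - ux t y) = ε * (2 * x / (1 + x ^ 2) + 2 * y / (1 + y ^ 2)) := by
        linarith
      rw [← abs_of_pos hE0, ← abs_mul, h₁, abs_mul, abs_of_pos hε]
      have h₂ := abs_add_le (2 * x / (1 + x ^ 2)) (2 * y / (1 + y ^ 2))
      have h₃ := abs_two_mul_div_one_add_sq_le x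
      have h₄ := abs_two_mul_div_one_add_sq_le y
      nlinarith
    have hhle : E * (h (u t x, ux t x) - h (u t y, ux t y))
        ≤ Lh * (E * (u t x - u t y)) + Lh * (2 * ε) := by
      have h₁ := hh.dist_le_mul (u t x, ux t x) (u t y, ux t y)
      rw [Real.dist_eq, Prod.dist_eq, Real.dist_eq, Real.dist_eq] at h₁
      have h₂ : max |u t x - u t y| |ux t x - ux t y|
          ≤ (u t x - u t y) + |ux t x - ux t y| := by
        rw [abs_of_nonneg hD]
        exact max_le (le_add_of_nonneg_right (abs_nonneg _)) (le_add_of_nonneg_left hD)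
      have h₃ := ((le_abs_self _).trans h₁).trans (mul_le_mul_of_nonneg_left h₂ hLh)
      have h₄ := mul_le_mul_of_nonneg_left h₃ hE0.le
      have h₅ := mul_le_mul_of_nonneg_left hgrad hLh
      linarith
    have hGx : E * (σu ^ 2 * max (uxx t x) 0 - σl ^ 2 * max (-uxx t x) 0) ≤ σu ^ 2 * (2 * ε) := by
      have h₁ : E * max (uxx t x) 0 ≤ 2 * ε := by
        rw [mul_max_of_nonneg _ _ hE0.le]
        exact max_le hx₂ (by simpa using hε.le)
      have h₂ : 0 ≤ E * (σl ^ 2 * max (-uxx t x) 0) := by positivity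
      linarith [mul_le_mul_of_nonneg_left h₁ hσu]
    have hGy : -(σu ^ 2 * (2 * ε))
        ≤ E * (σu ^ 2 * max (uxx t y) 0 - σl ^ 2 * max (-uxx t y) 0) := by
      have h₁ : E * max (-uxx t y) 0 ≤ 2 * ε := by
        rw [mul_max_of_nonneg _ _ hE0.le]
        exact max_le (by linarith) (by simpa using hε.le)
      have h₂ : 0 ≤ E * (σu ^ 2 * max (uxx t y) 0) := by positivity
      have h₃ : σl ^ 2 ≤ σu ^ 2 := pow_le_pow_left₀ hσl.le hσ 2
      have h₄ : 0 ≤ E * max (-uxx t y) 0 := by positivity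
      linarith [mul_le_mul_of_nonneg_left h₁ hσu, mul_le_mul_of_nonneg_right h₃ h₄]
    have hpx := congrArg (E * ·) (hpde t ht' x)
    have hpy := congrArg (E * ·) (hpde t ht' y)
    simp only [mul_zero, mul_add] at hpx hpy
    linarith [mul_pos hε hE0]
  have oneSided : ∀ t ∈ Icc 0 T, ∀ x y : ℝ,
      u t x - u t y ≤ (Lφ : ℝ) * exp ((Lh : ℝ) * (T - t)) * |x - y| := by
    intro t ht x y
    have hlim : exp (-(Lh * (T - t))) * (u t x - u t y) ≤ Lφ * |x - y| := by
      set B := log (1 + x ^ 2) + log (1 + y ^ 2) + (2 * σu ^ 2 + 2 * Lh + 1) * (T - t) with hB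
      have htend : Filter.Tendsto (fun ε : ℝ => Lφ * |x - y| + ε * B) (nhdsWithin 0 (Ioi 0))
          (nhds (Lφ * |x - y|)) := by
        have : Continuous fun ε : ℝ => Lφ * |x - y| + ε * B := by fun_prop
        simpa using (this.tendsto 0).mono_left nhdsWithin_le_nhds
      refine ge_of_tendsto htend ?_
      filter_upwards [self_mem_nhdsWithin] with ε hε
      have := key ε hε t ht x y
      rw [hB]
      linarith
    have h₁ := mul_le_mul_of_nonneg_left hlim (exp_pos (Lh * (T - t))).le
    rw [← mul_assoc, ← exp_add, add_neg_cancel, exp_zero, one_mul] at h₁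
    linarith
  have lipschitz : ∀ t ∈ Icc 0 T, ∀ x y : ℝ,
      |u t x - u t y| ≤ (Lφ : ℝ) * exp ((Lh : ℝ) * (T - t)) * |x - y| := fun t ht x y =>
    abs_sub_le_iff.2 ⟨oneSided t ht x y, abs_sub_comm x y ▸ oneSided t ht y x⟩
  refine ⟨lipschitz, fun t ht x => ?_⟩
  have h₁ : |ux t x| ≤ (Lφ : ℝ) * exp ((Lh : ℝ) * (T - t)) :=
    (hux t ht x).le_of_lip' (by positivity)
      (Filter.Eventually.of_forall fun y => lipschitz t ⟨ht.1, ht.2.le⟩ y x)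
  refine h₁.trans (mul_le_mul_of_nonneg_left (exp_le_exp.2 ?_) Lφ.coe_nonneg)
  exact mul_le_mul_of_nonneg_left (by linarith [ht.1]) Lh.coe_nonneg

end
end
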